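/- arXiv:2205.00151 — 2 statements merged into one kernel-verified Lean document; each statement's English description precedes it below -/
import Mathlib

section
/- Let q be a prime power and n ≥ 2 an integer, and let f ∈ F_q[x_1,…,x_n] with deg_{x_i}(f) < q for all i be a local permutation polynomial. If q = 2 then f has total degree at most 1 (f is linear), and if q > 2 then f has total degree at most n(q−2). -/
/-- A multivariate polynomial (viewed through its evaluation map) is a local
permutation polynomial if fixing all variables but one always yields a
bijection of the field. -/
def IsLPP {K : Type*} [CommSemiring K] {n : ℕ} (f : MvPolynomial (Fin n) K) : Prop :=
  ∀ (i : Fin n) (a : Fin n → K),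
    Function.Bijective fun x : K => MvPolynomial.eval (Function.update a i x) f

open MvPolynomial in
theorem aux_zero {K : Type*} [Field K] [Fintype K] {n : ℕ} (p : MvPolynomial (Fin n) K)
    (h : ∀ v, eval v p = 0) (hp : p ∈ restrictDegree (Fin n) K (Fintype.card K - 1)) : p = 0 := by
  have hc : 0 < Fintype.card K := Fintype.card_pos
  refine eq_zero_of_eval_zero_at_prod_finset p (fun _ => Finset.univ) ?_ (fun x _ => h x)
  intro i
  rw [Finset.card_univ, degreeOf_lt_iff hc]
  intro m hm
  have := (mem_restrictDegree _ _ _).1 hp m hm i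
  omega

open MvPolynomial in
theorem aux_deg {K : Type*} [Field K] [Fintype K] {n : ℕ}
    (f : MvPolynomial (Fin n) K)
    (hdeg : ∀ i : Fin n, f.degreeOf i < Fintype.card K)
    (hlpp : IsLPP f) (hq : 2 < Fintype.card K) (i : Fin n) (m : Fin n →₀ ℕ)
    (hm : m ∈ f.support) : m i ≤ Fintype.card K - 2 := by
  classical
  set q := Fintype.card K with hqdef
  have hmd : ∀ m ∈ f.support, ∀ j, m j ≤ q - 1 := by
    intro m hm j
    have := (degreeOf_lt_iff (by omega)).1 (hdeg j) m hm
    omega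
  by_contra hcon
  have hmi : m i = q - 1 := by have := hmd m hm i; omega
  have hsum1 : ∑ x : K, x ^ (q - 1) = -1 := by
    have h1 : ∀ x : K, x ^ (q - 1) = 1 - (if x = 0 then 1 else 0) := by
      intro x
      by_cases hx : x = 0
      · subst hx
        rw [zero_pow (by omega)]; simp
      · rw [FiniteField.pow_card_sub_one_eq_one x hx]; simp [hx]
    simp only [h1, Finset.sum_sub_distrib]
    simp
  let h : MvPolynomial (Fin n) K :=
    ∑ d ∈ f.support with d i = q - 1, monomial d (coeff d f)
  have hcoeff : ∀ d, coeff d h = if d ∈ f.support ∧ d i = q - 1 then coeff d f else 0 := by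
    intro d
    simp only [h, coeff_sum, coeff_monomial]
    rw [Finset.sum_ite_eq']
    simp only [Finset.mem_filter]
  have hz : h = 0 := by
    apply aux_zero
    · intro a
      have hS : ∑ x : K, eval (Function.update a i x) f = 0 := by
        rw [(hlpp i a).sum_comp (fun y => y)]
        have := FiniteField.sum_pow_lt_card_sub_one K 1 (by omega)
        simpa using this
      have key : eval a h = - a i ^ (q - 1) * ∑ x : K, eval (Function.update a i x) f := by
        simp only [h, map_sum, eval_monomial]
        simp only [eval_eq']
        rw [Finset.sum_comm, Finset.mul_sum, Finset.sum_filter]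
        apply Finset.sum_congr rfl
        intro d hd
        have e : ∀ b : Fin n → K, ∏ j, b j ^ d j = b i ^ d i * ∏ j ∈ Finset.univ.erase i, b j ^ d j :=
          fun b => (Finset.mul_prod_erase _ _ (Finset.mem_univ i)).symm
        have e2 : ∀ x : K, coeff d f * ∏ j, Function.update a i x j ^ d j
            = (coeff d f * ∏ j ∈ Finset.univ.erase i, a j ^ d j) * x ^ d i := by
          intro x
          rw [e]
          have : ∏ j ∈ Finset.univ.erase i, Function.update a i x j ^ d j
              = ∏ j ∈ Finset.univ.erase i, a j ^ d j := by
            apply Finset.prod_congr rfl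
            intro j hj
            rw [Function.update_of_ne (Finset.ne_of_mem_erase hj)]
          rw [this, Function.update_self]; ring
        simp only [e2, ← Finset.mul_sum]
        split_ifs with hdi
        · rw [hdi, hsum1, Finsupp.prod_fintype _ _ (by simp), e, hdi]; ring
        · rw [FiniteField.sum_pow_lt_card_sub_one K (d i)
            (by have := hmd d hd i; omega)]
          simp
      rw [key, hS, mul_zero]
    · rw [mem_restrictDegree]
      intro d hd j
      rw [mem_support_iff, hcoeff] at hd
      have : d ∈ f.support := by
        by_contra hn
        exact hd (if_neg (fun h => hn h.1))
      exact hmd d this j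
  have := hcoeff m
  rw [hz, if_pos ⟨hm, hmi⟩] at this
  exact (mem_support_iff.1 hm) (by simpa using this.symm)

open MvPolynomial in
theorem aux_two {K : Type*} [Field K] [Fintype K] {n : ℕ}
    (f : MvPolynomial (Fin n) K)
    (hdeg : ∀ i : Fin n, f.degreeOf i < Fintype.card K)
    (hlpp : IsLPP f) (hq : Fintype.card K = 2) : f.totalDegree ≤ 1 := by
  classical
  have h01 : ∀ x : K, x = 0 ∨ x = 1 := by
    intro x
    by_contra! hx
    have : ({0, 1, x} : Finset K).card ≤ 2 := hq ▸ Finset.card_le_univ _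
    rw [Finset.card_eq_three.2 ⟨0, 1, x, zero_ne_one, hx.1.symm, hx.2.symm, rfl⟩] at this
    omega
  have hadd : ∀ x y : K, x ≠ y → x = y + 1 := by
    intro x y hxy
    by_contra hne
    rcases h01 (x - y) with h | h
    · exact hxy (sub_eq_zero.1 h)
    · exact hne (by rw [← h]; ring)
  let p : MvPolynomial (Fin n) K := f - ∑ j, X j
  have hinv : ∀ (i : Fin n) (a : Fin n → K) (x : K),
      eval (Function.update a i x) p = eval (Function.update a i 0) p := by
    intro i a x
    rcases h01 x with rfl | rfl
    · rfl
    · have h1 := hadd (eval (Function.update a i 1) f) (eval (Function.update a i 0) f)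
        (fun h => one_ne_zero ((hlpp i a).1 h))
      simp only [p, map_sub, map_sum, eval_X, h1]
      rw [Finset.sum_update_of_mem (Finset.mem_univ i),
        Finset.sum_update_of_mem (Finset.mem_univ i)]
      ring
  have hconst : ∀ (a : Fin n → K) (s : Finset (Fin n)),
      eval (s.piecewise a 0) p = eval 0 p := by
    intro a s
    induction s using Finset.induction_on with
    | empty => simp
    | insert i s hi ih =>
      rw [Finset.piecewise_insert, hinv, ← hinv i _ (s.piecewise a 0 i), Function.update_eq_self, ih]
  have hf : f = ∑ j, X j + C (eval 0 p) := by
    rw [← sub_eq_zero]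
    apply aux_zero
    · intro a
      have := hconst a Finset.univ
      rw [Finset.piecewise_univ] at this
      simp only [map_sub, map_add, eval_C, ← this, p]
      ring
    · refine Submodule.sub_mem _ ?_ (Submodule.add_mem _ (Submodule.sum_mem _ ?_) ?_)
      · rw [mem_restrictDegree]
        intro d hd j
        have := (degreeOf_lt_iff (by omega)).1 (hdeg j) d hd
        omega
      · intro j _
        rw [mem_restrictDegree]
        intro d hd k
        rw [support_X, Finset.mem_singleton] at hd
        subst hd
        rw [Finsupp.single_apply]
        split_ifs <;> omega
      · rw [mem_restrictDegree]
        intro d hd k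
        rw [mem_support_iff, coeff_C] at hd
        have : (0 : Fin n →₀ ℕ) = d := by
          by_contra hn
          exact hd (if_neg hn)
        simp [← this]
  rw [hf]
  refine (totalDegree_add _ _).trans (max_le ?_ (by simp))
  exact totalDegree_finsetSum_le (fun j _ => by simp)

theorem stmt0 {K : Type*} [Field K] [Fintype K] {n : ℕ} (hn : 2 ≤ n)
    (f : MvPolynomial (Fin n) K)
    (hdeg : ∀ i : Fin n, f.degreeOf i < Fintype.card K)
    (hlpp : IsLPP f) :
    (Fintype.card K = 2 → f.totalDegree ≤ 1) ∧
      (2 < Fintype.card K → f.totalDegree ≤ n * (Fintype.card K - 2)) := by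
  refine ⟨aux_two f hdeg hlpp, fun hq => ?_⟩
  rw [MvPolynomial.totalDegree]
  apply Finset.sup_le
  intro m hm
  rw [Finsupp.sum_fintype _ _ (by simp)]
  refine (Finset.sum_le_card_nsmul _ _ _ (fun i _ => aux_deg f hdeg hlpp hq i m hm)).trans ?_
  simp
end

section
/- For every prime power q > 3 there exists a local permutation polynomial f ∈ F_q[x,y] with deg_x(f) < q and deg_y(f) < q whose total degree is exactly 2(q−2). -/
open Finset in
lemma aux_swap {K A : Type*} [AddCommMonoid A] (s : Finset ℕ) (u : Finset K)
    (F : ℕ → ℕ → K → K → A) :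
    ∑ i ∈ s, ∑ j ∈ s, ∑ a ∈ u, ∑ b ∈ u, F i j a b =
      ∑ a ∈ u, ∑ b ∈ u, ∑ i ∈ s, ∑ j ∈ s, F i j a b := by
  have h1 : ∀ i ∈ s, ∑ j ∈ s, ∑ a ∈ u, ∑ b ∈ u, F i j a b =
      ∑ a ∈ u, ∑ b ∈ u, ∑ j ∈ s, F i j a b := by
    intro i _
    rw [sum_comm]
    exact sum_congr rfl fun a _ => sum_comm
  rw [sum_congr rfl h1, sum_comm]
  exact sum_congr rfl fun a _ => sum_comm

open Finset in
lemma aux_R {K : Type*} [Field K] [Fintype K] [DecidableEq K] (a x : K) :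
    ∑ i ∈ range (Fintype.card K - 1), a ^ (Fintype.card K - 1 - i) * x ^ i
      = 1 - x ^ (Fintype.card K - 1) - (if a = x then 1 else 0) := by
  have hq : 1 < Fintype.card K := Fintype.one_lt_card
  have h1 : ∑ i ∈ range (Fintype.card K - 1), a ^ (Fintype.card K - 1 - i) * x ^ i
      = a * ∑ i ∈ range (Fintype.card K - 1), x ^ i * a ^ (Fintype.card K - 1 - 1 - i) := by
    rw [mul_sum]
    refine sum_congr rfl fun i hi => ?_
    have := mem_range.1 hi
    have h : Fintype.card K - 1 - i = (Fintype.card K - 1 - 1 - i) + 1 := by omega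
    rw [h, pow_succ]; ring
  by_cases hax : a = x
  · subst hax
    rw [if_pos rfl]
    have h2 : ∀ i ∈ range (Fintype.card K - 1), a ^ (Fintype.card K - 1 - i) * a ^ i
        = a ^ (Fintype.card K - 1) := by
      intro i hi
      have := mem_range.1 hi
      rw [← pow_add]; congr 1; omega
    rw [sum_congr rfl h2, sum_const, card_range, nsmul_eq_mul, Nat.cast_sub hq.le]
    simp
  · rw [if_neg hax, h1]
    have hg := geom_sum₂_mul x a (Fintype.card K - 1)
    have hne : x - a ≠ 0 := sub_ne_zero.2 (Ne.symm hax)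
    apply mul_right_cancel₀ hne
    rw [mul_assoc, hg]
    have hz : (0 : K) ^ (Fintype.card K - 1) = 0 := zero_pow (by omega)
    by_cases ha : a = 0
    · subst ha
      have hx : x ≠ 0 := fun h => hax h.symm
      rw [FiniteField.pow_card_sub_one_eq_one x hx]; ring
    · by_cases hx : x = 0
      · subst hx
        rw [FiniteField.pow_card_sub_one_eq_one a ha, hz]; ring
      · rw [FiniteField.pow_card_sub_one_eq_one a ha, FiniteField.pow_card_sub_one_eq_one x hx]; ring

lemma aux_sum {K : Type*} [Field K] [Fintype K] (hq : 3 < Fintype.card K) : ∑ x : K, x = 0 := by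
  have := FiniteField.sum_pow_lt_card_sub_one K 1 (by omega)
  simpa using this

open Finset MvPolynomial in
lemma aux_main {K : Type*} [Field K] [Fintype K] (hq : 3 < Fintype.card K) (L : K → K → K)
    (hr : ∀ a, Function.Bijective (L a)) (hc : ∀ b, Function.Bijective fun a => L a b)
    (hS : ∑ a, ∑ b, a * b * L a b ≠ 0) :
    ∃ f : MvPolynomial (Fin 2) K,
      (∀ i : Fin 2, f.degreeOf i < Fintype.card K) ∧
      IsLPP f ∧
      f.totalDegree = 2 * (Fintype.card K - 2) := by
  classical
  set q := Fintype.card K with hqd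
  have hsr : ∀ a, ∑ b, L a b = 0 := fun a =>
    ((hr a).sum_comp (fun x => x)).trans (aux_sum hq)
  have hsc : ∀ b, ∑ a, L a b = 0 := fun b =>
    ((hc b).sum_comp (fun x => x)).trans (aux_sum hq)
  let c : ℕ → ℕ → K := fun i j => ∑ a, ∑ b, L a b * a ^ (q - 1 - i) * b ^ (q - 1 - j)
  let e : ℕ → ℕ → (Fin 2 →₀ ℕ) := fun i j => Finsupp.single 0 i + Finsupp.single 1 j
  have e0 : ∀ i j, e i j 0 = i := by intro i j; simp [e]
  have e1 : ∀ i j, e i j 1 = j := by intro i j; simp [e]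
  let f : MvPolynomial (Fin 2) K :=
    ∑ i ∈ range (q - 1), ∑ j ∈ range (q - 1), monomial (e i j) (c i j)
  have hcoeff : ∀ m, coeff m f = ∑ i ∈ range (q - 1), ∑ j ∈ range (q - 1),
      if e i j = m then c i j else 0 := by
    intro m; simp only [f, coeff_sum, coeff_monomial]
  have hsupp : ∀ m ∈ f.support, m 0 < q - 1 ∧ m 1 < q - 1 := by
    intro m hm
    rw [mem_support_iff, hcoeff] at hm
    obtain ⟨i, hi, h⟩ := exists_ne_zero_of_sum_ne_zero hm
    obtain ⟨j, hj, h⟩ := exists_ne_zero_of_sum_ne_zero h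
    have hm : e i j = m := by by_contra h'; simp [h'] at h
    rw [← hm, e0, e1]
    exact ⟨mem_range.1 hi, mem_range.1 hj⟩
  have htop : coeff (e (q-2) (q-2)) f = c (q-2) (q-2) := by
    rw [hcoeff, sum_eq_single_of_mem (q-2) (mem_range.2 (by omega)),
      sum_eq_single_of_mem (q-2) (mem_range.2 (by omega)), if_pos rfl]
    · intro j _ hj
      refine if_neg fun h => hj ?_
      rw [← e1 (q-2) j, h, e1]
    · intro i _ hi
      refine sum_eq_zero fun j _ => if_neg fun h => hi ?_
      rw [← e0 i j, h, e0]
  have hcne : c (q-2) (q-2) ≠ 0 := by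
    have h : q - 1 - (q - 2) = 1 := by omega
    have : c (q-2) (q-2) = ∑ a, ∑ b, a * b * L a b := by
      simp only [c, h, pow_one]
      exact sum_congr rfl fun a _ => sum_congr rfl fun b _ => by ring
    rwa [this]
  have heval : ∀ v : Fin 2 → K, eval v f = L (v 0) (v 1) := by
    intro v
    have h1 : eval v f = ∑ a, ∑ b, L a b *
        (∑ i ∈ range (q - 1), a ^ (q - 1 - i) * v 0 ^ i) *
        (∑ j ∈ range (q - 1), b ^ (q - 1 - j) * v 1 ^ j) := by
      have hm : ∀ i j, eval v (monomial (e i j) (c i j)) =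
          ∑ a, ∑ b, L a b * a ^ (q - 1 - i) * b ^ (q - 1 - j) * (v 0 ^ i * v 1 ^ j) := by
        intro i j
        rw [eval_monomial, Finsupp.prod_fintype _ _ (by simp), Fin.prod_univ_two, e0, e1]
        simp only [c, sum_mul]
      simp only [f, map_sum, hm]
      have h2 : ∀ a b, L a b *
        (∑ i ∈ range (q - 1), a ^ (q - 1 - i) * v 0 ^ i) *
        (∑ j ∈ range (q - 1), b ^ (q - 1 - j) * v 1 ^ j) =
          ∑ i ∈ range (q - 1), ∑ j ∈ range (q - 1),
            L a b * a ^ (q - 1 - i) * b ^ (q - 1 - j) * (v 0 ^ i * v 1 ^ j) := by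
        intro a b
        rw [mul_assoc, sum_mul_sum, mul_sum]
        refine sum_congr rfl fun i _ => ?_
        rw [mul_sum]
        exact sum_congr rfl fun j _ => by ring
      simp only [h2]
      exact aux_swap _ _ _
    rw [h1]
    simp only [hqd, aux_R]
    have h3 : ∀ a, ∑ b, L a b * (1 - v 0 ^ (Fintype.card K - 1) - (if a = v 0 then 1 else 0)) *
        (1 - v 1 ^ (Fintype.card K - 1) - (if b = v 1 then 1 else 0)) =
        - ((1 - v 0 ^ (Fintype.card K - 1) - (if a = v 0 then 1 else 0)) * L a (v 1)) := by
      intro a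
      have : ∀ b, L a b * (1 - v 0 ^ (Fintype.card K - 1) - (if a = v 0 then 1 else 0)) *
        (1 - v 1 ^ (Fintype.card K - 1) - (if b = v 1 then 1 else 0)) =
        L a b * ((1 - v 0 ^ (Fintype.card K - 1) - (if a = v 0 then 1 else 0)) *
          (1 - v 1 ^ (Fintype.card K - 1)))
        - (if b = v 1 then (1 - v 0 ^ (Fintype.card K - 1) - (if a = v 0 then 1 else 0)) * L a b
            else 0) := by
        intro b
        by_cases hb : b = v 1
        · simp only [if_pos hb]; ring
        · simp only [if_neg hb]; ring
      simp only [this]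
      rw [sum_sub_distrib, ← sum_mul, hsr, sum_ite_eq' univ (v 1)]
      simp
    simp only [h3]
    have h4 : ∀ a, - ((1 - v 0 ^ (Fintype.card K - 1) - (if a = v 0 then 1 else 0)) * L a (v 1))
        = (if a = v 0 then L a (v 1) else 0) -
          L a (v 1) * (1 - v 0 ^ (Fintype.card K - 1)) := by
      intro a
      by_cases ha : a = v 0
      · simp only [if_pos ha]; ring
      · simp only [if_neg ha]; ring
    simp only [h4]
    rw [sum_sub_distrib, ← sum_mul, hsc, sum_ite_eq' univ (v 0)]
    simp
  refine ⟨f, ?_, ?_, ?_⟩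
  · intro i
    rw [degreeOf_lt_iff (by omega)]
    intro m hm
    have := hsupp m hm
    fin_cases i <;> simp <;> omega
  · intro i a
    simp only [heval]
    fin_cases i
    · simpa using hc (a 1)
    · simpa using hr (a 0)
  · apply le_antisymm
    · refine Finset.sup_le fun m hm => ?_
      have := hsupp m hm
      rw [Finsupp.sum_fintype _ _ (by simp), Fin.sum_univ_two]
      omega
    · have hm : e (q-2) (q-2) ∈ f.support := by
        rw [mem_support_iff, htop]; exact hcne
      have := le_totalDegree hm
      rw [Finsupp.sum_fintype _ _ (by simp), Fin.sum_univ_two, e0, e1] at this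
      omega

open Finset in
lemma aux_even {K : Type*} [Field K] [Fintype K] (hq : 3 < Fintype.card K) (h2 : (2 : K) = 0) :
    ∃ L : K → K → K, (∀ a, Function.Bijective (L a)) ∧ (∀ b, Function.Bijective fun a => L a b) ∧
      ∑ a, ∑ b, a * b * L a b ≠ 0 := by
  classical
  let L : K → K → K := fun x y => x + y + (if (x = 0 ∨ x = 1) ∧ (y = 0 ∨ y = 1) then 1 else 0)
  have hsymm : ∀ x y, L x y = L y x := by
    intro x y; simp only [L, add_comm x y, and_comm]
  have hinj : ∀ a, Function.Bijective (L a) := by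
    intro a
    apply Finite.injective_iff_bijective.1
    intro y z h
    simp only [L] at h
    grind
  refine ⟨L, hinj, fun b => ?_, ?_⟩
  · simp only [fun a => hsymm a b]; exact hinj b
  · have h0 := aux_sum hq
    have : ∀ a b : K, a * b * L a b = a ^ 2 * b + a * b ^ 2 +
        (if a = 1 then 1 else 0) * (if b = 1 then 1 else 0) := by
      intro a b
      simp only [L]
      split_ifs <;> grind
    simp only [this, sum_add_distrib]
    have t1 : ∑ a : K, ∑ b : K, a ^ 2 * b = 0 :=
      sum_eq_zero fun a _ => by rw [← mul_sum, h0, mul_zero]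
    have t2 : ∑ a : K, ∑ b : K, a * b ^ 2 = 0 := by
      rw [← sum_mul_sum, h0, zero_mul]
    rw [t1, t2]
    simp

open Finset in
lemma aux_odd {K : Type*} [Field K] [Fintype K] (hq : 3 < Fintype.card K) (h2 : (2 : K) ≠ 0) :
    ∃ L : K → K → K, (∀ a, Function.Bijective (L a)) ∧ (∀ b, Function.Bijective fun a => L a b) ∧
      ∑ a, ∑ b, a * b * L a b ≠ 0 := by
  classical
  obtain ⟨w, hw⟩ : ∃ w : K, w ∉ ({0, 1, 2} : Finset K) := by
    by_contra! h
    have h1 : (univ : Finset K) ⊆ {0, 1, 2} := fun x _ => h x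
    have h2 := card_le_card h1
    rw [card_univ] at h2
    have h3 : #({0, 1, 2} : Finset K) ≤ 3 := card_le_three
    omega
  have hw0 : w ≠ 0 := by rintro rfl; simp at hw
  have hw1 : w ≠ 1 := by rintro rfl; simp at hw
  have hw2 : w ≠ 2 := by rintro rfl; simp at hw
  let α : Equiv.Perm K := Equiv.swap 0 1
  let γ : Equiv.Perm K := Equiv.swap 0 w
  have h0 := aux_sum hq
  have hα : ∀ a, α a = a + ((if a = 0 then 1 else 0) - (if a = 1 then 1 else 0)) := by
    intro a
    simp only [α, Equiv.swap_apply_def]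
    grind
  have hα0 : ∑ a, α a = 0 := (Equiv.sum_comp α (fun x => x)).trans h0
  have hγ0 : ∑ a, γ a = 0 := (Equiv.sum_comp γ (fun x => x)).trans h0
  have key : ∀ g : K → K, ∑ a, α a * g a = ∑ a, a * g a + g 0 - g 1 := by
    intro g
    simp only [hα, add_mul, sub_mul, sum_add_distrib, sum_sub_distrib]
    simp
    ring
  have hshift : ∀ a, ∑ b, b * γ (a + b) = ∑ b, b * γ b := by
    intro a
    rw [← Equiv.sum_comp (Equiv.addLeft (-a)) (fun b => b * γ (a + b))]
    simp only [Equiv.coe_addLeft, add_neg_cancel_left, add_mul, sum_add_distrib, ← mul_sum, hγ0]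
    simp
  refine ⟨fun x y => γ (α x + α y), fun a => ?_, fun b => ?_, ?_⟩
  · exact γ.bijective.comp ((Equiv.addLeft (α a)).bijective.comp α.bijective)
  · exact γ.bijective.comp ((Equiv.addRight (α b)).bijective.comp α.bijective)
  · have e1 : ∑ a, ∑ b, a * b * γ (α a + α b) = ∑ a, α a * ∑ b, α b * γ (a + b) := by
      rw [← Equiv.sum_comp α]
      refine sum_congr rfl fun a _ => ?_
      rw [← Equiv.sum_comp α, mul_sum]
      refine sum_congr rfl fun b _ => ?_
      simp only [α, Equiv.swap_apply_self]
      simp [mul_assoc]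
    rw [e1]
    have e2 : ∀ a, ∑ b, α b * γ (a + b) = ∑ b, b * γ b + γ a - γ (1 + a) := by
      intro a; rw [key, hshift, add_zero, add_comm a 1]
    simp only [e2, mul_sub, mul_add, sum_add_distrib, sum_sub_distrib, ← sum_mul, hα0]
    rw [key]
    have g0 : γ 0 = w := by simp [γ]
    have g1 : γ 1 = 1 := Equiv.swap_apply_of_ne_of_ne one_ne_zero hw1.symm
    have g2 : γ 2 = 2 := Equiv.swap_apply_of_ne_of_ne h2 hw2.symm
    rw [one_add_one_eq_two, g0, g1, g2]
    intro h
    apply hw0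
    linear_combination h

theorem stmt8 {K : Type*} [Field K] [Fintype K] (hq : 3 < Fintype.card K) :
    ∃ f : MvPolynomial (Fin 2) K,
      (∀ i : Fin 2, f.degreeOf i < Fintype.card K) ∧
      IsLPP f ∧
      f.totalDegree = 2 * (Fintype.card K - 2) := by
  by_cases h2 : (2 : K) = 0
  · obtain ⟨L, h1, h2, h3⟩ := aux_even hq h2
    exact aux_main hq L h1 h2 h3
  · obtain ⟨L, h1, h2, h3⟩ := aux_odd hq h2
    exact aux_main hq L h1 h2 h3
end
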